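/- Let g ≥ 1, let τ be a symmetric complex g×g matrix with positive definite imaginary part, and let ε, δ ∈ ℤ^g. Then for every fixed τ, the function z ↦ θ[ε,δ](τ, z) is (complex) differentiable on all of ℂ^g. -/

import Mathlib

open Matrix Complex

/-- The general term of the theta series with characteristic `[ε,δ]`. -/
noncomputable def thetaTerm (g : ℕ) (ε δ : Fin g → ℤ) (τ : Matrix (Fin g) (Fin g) ℂ)
    (z : Fin g → ℂ) (m : Fin g → ℤ) : ℂ :=
  Complex.exp ((Real.pi : ℂ) * Complex.I *
    ((fun i => (m i : ℂ) + (ε i : ℂ) / 2) ⬝ᵥ (τ *ᵥ fun i => (m i : ℂ) + (ε i : ℂ) / 2)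
      + 2 * ((fun i => (m i : ℂ) + (ε i : ℂ) / 2) ⬝ᵥ fun i => z i + (δ i : ℂ) / 2)))

/-- The theta function with characteristic `[ε,δ]`:
`θ[ε,δ](τ,z) = ∑_{m ∈ ℤ^g} exp(πi·((m+ε/2)·(τ(m+ε/2)) + 2(m+ε/2)·(z+δ/2)))`. -/
noncomputable def thetaChar (g : ℕ) (ε δ : Fin g → ℤ) (τ : Matrix (Fin g) (Fin g) ℂ)
    (z : Fin g → ℂ) : ℂ :=
  ∑' m : Fin g → ℤ, thetaTerm g ε δ τ z m

/-- A product of nonnegative summable functions of separate variables is summable. -/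
theorem summable_prod_apply {ι κ : Type*} [Fintype ι] {f : ι → κ → ℝ}
    (hf : ∀ i k, 0 ≤ f i k) (hs : ∀ i, Summable (f i)) :
    Summable fun m : ι → κ => ∏ i, f i (m i) := by
  classical
  refine summable_of_sum_le (c := ∏ i, ∑' k, f i k)
    (fun m => Finset.prod_nonneg fun i _ => hf i _) fun u => ?_
  calc ∑ m ∈ u, ∏ i, f i (m i)
      ≤ ∑ m ∈ Fintype.piFinset fun i => u.image fun m => m i, ∏ i, f i (m i) := by
        refine Finset.sum_le_sum_of_subset_of_nonneg (fun m hm => ?_)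
          fun m _ _ => Finset.prod_nonneg fun i _ => hf i _
        exact Fintype.mem_piFinset.2 fun i => Finset.mem_image_of_mem _ hm
    _ = ∏ i, ∑ k ∈ u.image fun m => m i, f i k := (Finset.prod_univ_sum _ _).symm
    _ ≤ ∏ i, ∑' k, f i k :=
        Finset.prod_le_prod (fun i _ => Finset.sum_nonneg fun k _ => hf i k)
          fun i _ => (hs i).sum_le_tsum _ fun k _ => hf i k

/-- The quadratic form of a positive definite real matrix dominates a positive multiple of the
sum of squares. -/
theorem Matrix.PosDef.exists_pos_mul_sum_sq_le {n : Type*} [Fintype n] {Y : Matrix n n ℝ}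
    (hY : Y.PosDef) : ∃ c : ℝ, 0 < c ∧ ∀ x : n → ℝ, c * ∑ i, x i ^ 2 ≤ x ⬝ᵥ (Y *ᵥ x) := by
  cases isEmpty_or_nonempty n with
  | inl h => exact ⟨1, one_pos, fun x => by simp [dotProduct]⟩
  | inr h =>
    have hcont : Continuous fun x : n → ℝ => x ⬝ᵥ (Y *ᵥ x) := by
      simp only [dotProduct, mulVec]
      fun_prop
    obtain ⟨x₀, hx₀, hmin⟩ := (isCompact_sphere (0 : n → ℝ) 1).exists_isMinOn
      (NormedSpace.sphere_nonempty.2 zero_le_one) hcont.continuousOn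
    have hpos : 0 < x₀ ⬝ᵥ (Y *ᵥ x₀) := by
      simpa using hY.dotProduct_mulVec_pos (ne_zero_of_mem_unit_sphere ⟨x₀, hx₀⟩)
    have hcard : (0 : ℝ) < Fintype.card n := by exact_mod_cast Fintype.card_pos
    refine ⟨x₀ ⬝ᵥ (Y *ᵥ x₀) / Fintype.card n, by positivity, fun x => ?_⟩
    rcases eq_or_ne x 0 with rfl | hx
    · simp
    have hx' : 0 < ‖x‖ := norm_pos_iff.2 hx
    have hmem : ‖x‖⁻¹ • x ∈ Metric.sphere (0 : n → ℝ) 1 := by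
      simp [norm_smul, hx'.ne']
    have hle : x₀ ⬝ᵥ (Y *ᵥ x₀) ≤ (‖x‖⁻¹ • x) ⬝ᵥ (Y *ᵥ (‖x‖⁻¹ • x)) := hmin hmem
    rw [mulVec_smul, smul_dotProduct, dotProduct_smul, smul_eq_mul, smul_eq_mul, ← mul_assoc,
      ← mul_inv, ← div_eq_inv_mul, le_div_iff₀ (by positivity)] at hle
    have hsum : ∑ i, x i ^ 2 ≤ Fintype.card n * (‖x‖ * ‖x‖) := by
      calc ∑ i, x i ^ 2 ≤ ∑ _i : n, ‖x‖ * ‖x‖ := Finset.sum_le_sum fun i _ => by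
            rw [← sq, ← sq_abs]
            gcongr
            exact norm_le_pi_norm x i
        _ = _ := by simp
    calc x₀ ⬝ᵥ (Y *ᵥ x₀) / Fintype.card n * ∑ i, x i ^ 2
        ≤ x₀ ⬝ᵥ (Y *ᵥ x₀) / Fintype.card n * (Fintype.card n * (‖x‖ * ‖x‖)) := by gcongr
      _ = x₀ ⬝ᵥ (Y *ᵥ x₀) * (‖x‖ * ‖x‖) := by field_simp
      _ ≤ _ := hle

/-- A Gaussian times an exponential is summable over a translate of the integers. -/
theorem summable_exp_neg_mul_sq_add_mul_abs {c : ℝ} (hc : 0 < c) {b : ℝ} (hb : 0 ≤ b) (a : ℝ) :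
    Summable fun n : ℤ => Real.exp (-Real.pi * c * (n + a) ^ 2 + b * |n + a|) := by
  have h := (summable_pow_mul_jacobiTheta₂_term_bound (b / (2 * Real.pi)) (half_pos hc) 0).mul_left
    (Real.exp (Real.pi * c * a ^ 2 + b * |a|))
  refine Summable.of_nonneg_of_le (fun n => (Real.exp_pos _).le) (fun n => ?_) h
  rw [pow_zero, one_mul, ← Real.exp_add, Real.exp_le_exp]
  have hsq : (n : ℝ) ^ 2 / 2 - a ^ 2 ≤ (n + a) ^ 2 := by nlinarith [sq_nonneg ((n : ℝ) + 2 * a)]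
  have hπ : -Real.pi * (c / 2 * n ^ 2 - 2 * (b / (2 * Real.pi)) * |(n : ℝ)|)
      = -(Real.pi * c) * (n ^ 2 / 2) + b * |(n : ℝ)| := by
    field_simp
    ring
  have hab : b * |(n : ℝ) + a| ≤ b * |(n : ℝ)| + b * |a| := by
    rw [← mul_add]
    exact mul_le_mul_of_nonneg_left (abs_add_le _ _) hb
  have hmul := mul_le_mul_of_nonneg_left hsq (mul_pos Real.pi_pos hc).le
  push_cast
  rw [hπ]
  linarith

/-- The exact absolute value of a term of the theta series. -/
theorem norm_thetaTerm (g : ℕ) (ε δ : Fin g → ℤ) (τ : Matrix (Fin g) (Fin g) ℂ)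
    (z : Fin g → ℂ) (m : Fin g → ℤ) :
    ‖thetaTerm g ε δ τ z m‖ = Real.exp (-Real.pi *
      ((fun i => (m i + ε i / 2 : ℝ)) ⬝ᵥ
          ((Matrix.of fun i j => (τ i j).im) *ᵥ fun i => (m i + ε i / 2 : ℝ))
        + 2 * ∑ i, (m i + ε i / 2 : ℝ) * (z i).im)) := by
  have hx : ∀ i, (m i : ℂ) + (ε i : ℂ) / 2 = ((m i + ε i / 2 : ℝ) : ℂ) := fun i => by push_cast; rfl
  have hz : ∀ i, (z i + (δ i : ℂ) / 2).im = (z i).im := fun i => by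
    rw [show (δ i : ℂ) / 2 = ((δ i / 2 : ℝ) : ℂ) by push_cast; rfl, Complex.add_im,
      Complex.ofReal_im, add_zero]
  have htwo : ∀ w : ℂ, (2 * w).im = 2 * w.im := Complex.im_ofReal_mul 2
  rw [thetaTerm, Complex.norm_exp, mul_assoc, Complex.re_ofReal_mul, Complex.I_mul_re, neg_mul,
    mul_neg]
  simp only [hx, dotProduct, mulVec, Complex.add_im, Complex.im_sum, Complex.im_ofReal_mul,
    Complex.im_mul_ofReal, Matrix.of_apply, hz, htwo]

/-- The derivative in `z` of a term of the theta series. -/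
theorem hasFDerivAt_thetaTerm (g : ℕ) (ε δ : Fin g → ℤ) (τ : Matrix (Fin g) (Fin g) ℂ)
    (z : Fin g → ℂ) (m : Fin g → ℤ) :
    HasFDerivAt (fun z => thetaTerm g ε δ τ z m)
      (thetaTerm g ε δ τ z m • ((Real.pi : ℂ) * Complex.I * 2) •
        ∑ i, ((m i : ℂ) + (ε i : ℂ) / 2) • ContinuousLinearMap.proj (R := ℂ) (φ := fun _ => ℂ) i)
      z := by
  have hlin : HasFDerivAt
      (fun z : Fin g → ℂ => ∑ i, ((m i : ℂ) + (ε i : ℂ) / 2) * (z i + (δ i : ℂ) / 2))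
      (∑ i, ((m i : ℂ) + (ε i : ℂ) / 2) • ContinuousLinearMap.proj (R := ℂ) (φ := fun _ => ℂ) i)
      z :=
    HasFDerivAt.fun_sum fun i _ => ((hasFDerivAt_apply i z).add_const _).const_mul _
  have h := (((hlin.const_mul 2).const_add ((fun i => (m i : ℂ) + (ε i : ℂ) / 2) ⬝ᵥ
    (τ *ᵥ fun i => (m i : ℂ) + (ε i : ℂ) / 2))).const_mul ((Real.pi : ℂ) * Complex.I)).cexp
  rw [smul_smul ((Real.pi : ℂ) * Complex.I)] at h
  exact h

/-- Termwise bound on the theta series, uniform for `z` in a bounded set; the factor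
`exp (∑ |mᵢ + εᵢ / 2|)` leaves room for the derivative. -/
theorem exp_mul_norm_thetaTerm_le {g : ℕ} (ε δ : Fin g → ℤ) {τ : Matrix (Fin g) (Fin g) ℂ}
    {c : ℝ} (hc : ∀ x : Fin g → ℝ,
      c * ∑ i, x i ^ 2 ≤ x ⬝ᵥ ((Matrix.of fun i j => (τ i j).im) *ᵥ x))
    {R : ℝ} {z : Fin g → ℂ} (hz : ‖z‖ ≤ R) (m : Fin g → ℤ) :
    Real.exp (∑ i, |(m i + ε i / 2 : ℝ)|) * ‖thetaTerm g ε δ τ z m‖ ≤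
      ∏ i, Real.exp (-Real.pi * c * (m i + ε i / 2 : ℝ) ^ 2
        + (2 * Real.pi * R + 1) * |(m i + ε i / 2 : ℝ)|) := by
  rw [norm_thetaTerm, ← Real.exp_add, ← Real.exp_sum, Real.exp_le_exp]
  have hquad := mul_le_mul_of_nonneg_left (hc fun i => (m i + ε i / 2 : ℝ)) Real.pi_pos.le
  have him : -∑ i, (m i + ε i / 2 : ℝ) * (z i).im ≤ R * ∑ i, |(m i + ε i / 2 : ℝ)| := by
    rw [← Finset.sum_neg_distrib, Finset.mul_sum]
    refine Finset.sum_le_sum fun i _ => (neg_le_abs _).trans ?_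
    rw [abs_mul, mul_comm]
    gcongr
    exact (Complex.abs_im_le_norm _).trans ((norm_le_pi_norm z i).trans hz)
  have hlin := mul_le_mul_of_nonneg_left him Real.pi_pos.le
  rw [Finset.sum_add_distrib, ← Finset.mul_sum, ← Finset.mul_sum]
  linarith

/-- for `τ` in the Siegel upper half-space (symmetric with positive definite
imaginary part), the function `z ↦ θ[ε,δ](τ, z)` is complex differentiable on all of `ℂ^g`. -/
theorem thetaChar_differentiable (g : ℕ) (hg : 1 ≤ g) (τ : Matrix (Fin g) (Fin g) ℂ)
    (hτsymm : τ.IsSymm)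
    (hτ : (Matrix.of fun i j => (τ i j).im : Matrix (Fin g) (Fin g) ℝ).PosDef)
    (ε δ : Fin g → ℤ) :
    Differentiable ℂ (fun z : Fin g → ℂ => thetaChar g ε δ τ z) := by
  obtain ⟨c, hc, hquad⟩ := hτ.exists_pos_mul_sum_sq_le
  intro z₀
  set R : ℝ := ‖z₀‖ + 1
  have hR : 0 < R := by positivity
  have hsum : Summable fun m : Fin g → ℤ => ∏ i, Real.exp (-Real.pi * c * (m i + ε i / 2 : ℝ) ^ 2
      + (2 * Real.pi * R + 1) * |(m i + ε i / 2 : ℝ)|) :=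
    summable_prod_apply (f := fun i (n : ℤ) => Real.exp (-Real.pi * c * (n + ε i / 2 : ℝ) ^ 2
      + (2 * Real.pi * R + 1) * |(n + ε i / 2 : ℝ)|)) (fun i n => (Real.exp_pos _).le)
      fun i => summable_exp_neg_mul_sq_add_mul_abs hc (by positivity) _
  have hmem : z₀ ∈ Metric.ball (0 : Fin g → ℂ) R := by simp [R]
  refine (hasFDerivAt_tsum_of_isPreconnected (hsum.mul_left (2 * Real.pi)) Metric.isOpen_ball
    (convex_ball (0 : Fin g → ℂ) R).isPreconnected
    (fun m z _ => hasFDerivAt_thetaTerm g ε δ τ z m) (fun m z hz => ?_) hmem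
    (hsum.of_norm_bounded fun m => ?_) hmem).differentiableAt
  · have hL : ‖∑ i, ((m i : ℂ) + (ε i : ℂ) / 2) •
        ContinuousLinearMap.proj (R := ℂ) (φ := fun _ : Fin g => ℂ) i‖ ≤
        Real.exp (∑ i, |(m i + ε i / 2 : ℝ)|) := by
      refine (norm_sum_le_of_le _ fun i _ => ?_).trans
        ((le_add_of_nonneg_right zero_le_one).trans (Real.add_one_le_exp _))
      have hx : ‖(m i : ℂ) + (ε i : ℂ) / 2‖ = |(m i + ε i / 2 : ℝ)| := by
        rw [← Real.norm_eq_abs, ← Complex.norm_real]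
        push_cast
        rfl
      rw [norm_smul, hx]
      refine mul_le_of_le_one_right (abs_nonneg _) ?_
      exact ContinuousLinearMap.opNorm_le_bound _ zero_le_one fun z => by
        simpa using norm_le_pi_norm z i
    have hπ : ‖(Real.pi : ℂ) * Complex.I * 2‖ = 2 * Real.pi := by
      simp [abs_of_pos Real.pi_pos, mul_comm]
    have hb := exp_mul_norm_thetaTerm_le ε δ hquad (mem_ball_zero_iff.1 hz).le m
    rw [norm_smul, norm_smul, hπ, mul_left_comm, mul_comm ‖thetaTerm g ε δ τ z m‖]
    gcongr
    exact (mul_le_mul_of_nonneg_right hL (norm_nonneg _)).trans hb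
  · refine le_trans ?_ (exp_mul_norm_thetaTerm_le ε δ hquad (mem_ball_zero_iff.1 hmem).le m)
    exact le_mul_of_one_le_left (norm_nonneg _)
      (Real.one_le_exp (Finset.sum_nonneg fun i _ => abs_nonneg _))
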